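/- arXiv:1910.02997 — 2 statements merged into one kernel-verified Lean document; each statement's English description precedes it below -/
import Mathlib

section
/- Let G = (V,E) be an MPDAG and let (V_1,…,V_k), k ≥ 1, be the bucket decomposition of V ordered as a partial causal ordering in G. Then every strictly positive discrete observational density f over V consistent with G factorizes as f(v) = ∏_{i=1}^{k} f(v_i | pa(v_i,G)). -/
open scoped Classical

noncomputable section

/-- A partially directed graph on node type `V`: directed (`dir`) and undirected (`undir`)
edges, with at most one edge between any two nodes. -/
structure PDG (V : Type) where
  dir : V → V → Prop
  undir : V → V → Prop
  undir_symm : ∀ a b, undir a b → undir b a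
  dir_irrefl : ∀ a, ¬ dir a a
  undir_irrefl : ∀ a, ¬ undir a a
  dir_asymm : ∀ a b, dir a b → ¬ dir b a
  dir_not_undir : ∀ a b, dir a b → ¬ undir a b

namespace PDG

variable {V : Type}

/-- Two nodes are adjacent if there is an edge between them. -/
def Adj (G : PDG V) (a b : V) : Prop := G.dir a b ∨ G.dir b a ∨ G.undir a b

/-- No directed cycles. -/
def Acyclic (G : PDG V) : Prop := ∀ a, ¬ Relation.TransGen G.dir a a

/-- A maximally oriented PDAG (MPDAG): a partially directed graph with no directed
cycles, in which none of the four configurations of Meek's orientation rules occurs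
as an induced subgraph. -/
structure IsMPDAG (G : PDG V) : Prop where
  acyclic : G.Acyclic
  meek1 : ∀ a b c, G.dir a b → G.undir b c → G.Adj a c
  meek2 : ∀ a b c, G.dir a b → G.dir b c → ¬ G.undir a c
  meek3 : ∀ i j k l, k ≠ l → G.undir i j → G.undir i k → G.undir i l →
      G.dir k j → G.dir l j → G.Adj k l
  meek4 : ∀ i j k l, G.undir i j → G.undir i k → G.undir i l →
      G.dir j l → G.dir l k → G.Adj j k

/-- A DAG: only directed edges, no directed cycles. -/
def IsDAG (G : PDG V) : Prop := (∀ a b, ¬ G.undir a b) ∧ G.Acyclic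

/-- `⟨a,b,c⟩` is an unshielded collider. -/
def UnshieldedCollider (G : PDG V) (a b c : V) : Prop :=
  a ≠ c ∧ G.dir a b ∧ G.dir c b ∧ ¬ G.Adj a c

/-- `D ∈ [G]` : `D` is a DAG represented by the MPDAG `G`: same adjacencies,
same unshielded colliders, containing every directed edge of `G`. -/
def InClassOf (D G : PDG V) : Prop :=
  IsDAG D ∧ (∀ a b, G.Adj a b ↔ D.Adj a b) ∧
    (∀ a b c, G.UnshieldedCollider a b c ↔ D.UnshieldedCollider a b c) ∧
    (∀ a b, G.dir a b → D.dir a b)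

/-- `p` is a path: a sequence of at least two distinct nodes in which every pair of
successive nodes is adjacent. -/
def IsPath (G : PDG V) (p : List V) : Prop :=
  2 ≤ p.length ∧ p.Nodup ∧ p.Chain' G.Adj

/-- `p` is a path from `a` to `b`. -/
def IsPathFrom (G : PDG V) (p : List V) (a b : V) : Prop :=
  G.IsPath p ∧ p.head? = some a ∧ p.getLast? = some b

/-- `p` is a possibly causal path: no edge `V_i ← V_j` with `i < j` is in `G`. -/
def PossiblyCausal (G : PDG V) (p : List V) : Prop :=
  G.IsPath p ∧ ∀ i j : Fin p.length, (i : ℕ) < (j : ℕ) → ¬ G.dir (p.get j) (p.get i)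

/-- `p` is a causal path: all edges directed towards the endpoint. -/
def IsCausal (G : PDG V) (p : List V) : Prop :=
  2 ≤ p.length ∧ p.Nodup ∧ p.Chain' G.dir

/-- `p` is an undirected path. -/
def IsUndirPath (G : PDG V) (p : List V) : Prop :=
  p ≠ [] ∧ p.Nodup ∧ p.Chain' G.undir

/-- `p` is unshielded: every two nodes at distance two on `p` are nonadjacent. -/
def Unshielded (G : PDG V) (p : List V) : Prop :=
  ∀ (i : ℕ) (h : i + 2 < p.length),
    ¬ G.Adj (p.get ⟨i, by omega⟩) (p.get ⟨i + 2, h⟩)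

/-- `p` is proper w.r.t. the node set `X` : only its first node is in `X`. -/
def ProperFrom (X : Finset V) (p : List V) : Prop :=
  (∃ a ∈ X, p.head? = some a) ∧ ∀ i : Fin p.length, 0 < (i : ℕ) → p.get i ∉ X

/-- the last node of `p` is in `Y`. -/
def EndsIn (Y : Finset V) (p : List V) : Prop := ∃ b ∈ Y, p.getLast? = some b

/-- `p` starts with an undirected edge. -/
def StartsUndirected (G : PDG V) (p : List V) : Prop :=
  ∃ a b l, p = a :: b :: l ∧ G.undir a b

/-- There is no proper possibly causal path from `X` to `Y` in `G` that starts with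
an undirected edge. -/
def NoProperPCUndirStart (G : PDG V) (X Y : Finset V) : Prop :=
  ¬ ∃ p, G.PossiblyCausal p ∧ ProperFrom X p ∧ EndsIn Y p ∧ G.StartsUndirected p

/-- `A` is an undirected connected node set in `G`: every two distinct nodes of `A`
are joined by an undirected path in `G`. -/
def UndirConnected (G : PDG V) (A : Finset V) : Prop :=
  ∀ a ∈ A, ∀ b ∈ A, a ≠ b →
    ∃ p, G.IsUndirPath p ∧ p.head? = some a ∧ p.getLast? = some b

/-- `B` is a bucket in `D`: a maximal undirected connected subset of `D` in `G`. -/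
def Bucket (G : PDG V) (B D : Finset V) : Prop :=
  B.Nonempty ∧ B ⊆ D ∧ G.UndirConnected B ∧
    ∀ B' : Finset V, B ⊆ B' → B' ⊆ D → G.UndirConnected B' → B' = B

section DecEq

variable [DecidableEq V]

/-- `Bs` lists the bucket decomposition of `D`: the listed sets are buckets in `D`,
pairwise disjoint, with union `D`. -/
def IsBucketDecompList (G : PDG V) (D : Finset V) (Bs : List (Finset V)) : Prop :=
  (∀ B ∈ Bs, G.Bucket B D) ∧ (Bs.Pairwise fun B B' => Disjoint B B') ∧
    Bs.foldr (· ∪ ·) ∅ = D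

end DecEq

/-- The listed node sets are totally ordered as a partial causal ordering in `G` :
every edge between an earlier set and a later one points towards the later one. -/
def OrderedDecomp (G : PDG V) (Bs : List (Finset V)) : Prop :=
  ∀ i j : Fin Bs.length, (i : ℕ) < (j : ℕ) →
    ∀ a ∈ Bs.get i, ∀ b ∈ Bs.get j, G.Adj a b → G.dir a b

/-- the node at (interior) position `i` of `p` is a collider on `p`. -/
def ColliderAt (G : PDG V) (p : List V) (i : ℕ) : Prop :=
  ∃ u v w, p[i-1]? = some u ∧ p[i]? = some v ∧ p[i+1]? = some w ∧
    1 ≤ i ∧ G.dir u v ∧ G.dir w v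

/-- the node at (interior) position `i` of `p` is a definite non-collider on `p`. -/
def DefNonColliderAt (G : PDG V) (p : List V) (i : ℕ) : Prop :=
  ∃ u v w, p[i-1]? = some u ∧ p[i]? = some v ∧ p[i+1]? = some w ∧ 1 ≤ i ∧
    (G.dir v u ∨ G.dir v w ∨ (G.undir u v ∧ G.undir v w ∧ ¬ G.Adj u w))

/-- `p` is a definite status path: every interior node is a collider or a definite
non-collider on `p`. -/
def DefiniteStatus (G : PDG V) (p : List V) : Prop :=
  ∀ i : ℕ, 1 ≤ i → i + 1 < p.length → G.ColliderAt p i ∨ G.DefNonColliderAt p i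

/-- `p` is d-connecting given `Z` (in a DAG): every non-collider on `p` is outside
`Z` and every collider on `p` has a descendant in `Z`. -/
def DConnGiven (G : PDG V) (Z : Finset V) (p : List V) : Prop :=
  (∀ i u, 1 ≤ i → i + 1 < p.length → p[i]? = some u → ¬ G.ColliderAt p i → u ∉ Z) ∧
  (∀ i u, G.ColliderAt p i → p[i]? = some u →
    ∃ z ∈ Z, Relation.ReflTransGen G.dir u z)

/-- `A` and `B` are d-separated given `Z` : no path between them is d-connecting
given `Z`. -/
def DSep (G : PDG V) (A B Z : Finset V) : Prop :=
  ∀ p a b, a ∈ A → b ∈ B → G.IsPathFrom p a b → ¬ G.DConnGiven Z p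

/-- `p` is d-connecting given `Z` (definite status version): every definite
non-collider on `p` is outside `Z` and every collider on `p` has a descendant in `Z`. -/
def DConnDS (G : PDG V) (Z : Finset V) (p : List V) : Prop :=
  (∀ i u, G.DefNonColliderAt p i → p[i]? = some u → u ∉ Z) ∧
  (∀ i u, G.ColliderAt p i → p[i]? = some u →
    ∃ z ∈ Z, Relation.ReflTransGen G.dir u z)

/-- `Z` blocks the (definite status) path `p`. -/
def Blocks (G : PDG V) (Z : Finset V) (p : List V) : Prop := ¬ G.DConnDS Z p

/-- `D_{X̄}` : remove all edges into `X`. -/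
def removeInto (D : PDG V) (X : Finset V) : PDG V where
  dir a b := D.dir a b ∧ b ∉ X
  undir := D.undir
  undir_symm := D.undir_symm
  dir_irrefl := fun a h => D.dir_irrefl a h.1
  undir_irrefl := D.undir_irrefl
  dir_asymm := fun a b h h' => D.dir_asymm a b h.1 h'.1
  dir_not_undir := fun a b h => D.dir_not_undir a b h.1

/-- `D_{X̲}` : remove all edges out of `X`. -/
def removeOutOf (D : PDG V) (X : Finset V) : PDG V where
  dir a b := D.dir a b ∧ a ∉ X
  undir := D.undir
  undir_symm := D.undir_symm
  dir_irrefl := fun a h => D.dir_irrefl a h.1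
  undir_irrefl := D.undir_irrefl
  dir_asymm := fun a b h h' => D.dir_asymm a b h.1 h'.1
  dir_not_undir := fun a b h => D.dir_not_undir a b h.1

/-- `w'` is a possible descendant of `w` in `G`. -/
def PossibleDesc (G : PDG V) (w w' : V) : Prop :=
  w = w' ∨ ∃ p, G.PossiblyCausal p ∧ p.head? = some w ∧ p.getLast? = some w'

section Fin

variable [Fintype V] [DecidableEq V]

/-- the parents of the node `v` in `G`. -/
def paFin (G : PDG V) (v : V) : Finset V := Finset.univ.filter fun u => G.dir u v

/-- `Pa(S, G)` : the parents of the node set `S` in `G`, excluding `S` itself. -/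
def PaFin (G : PDG V) (S : Finset V) : Finset V :=
  (Finset.univ.filter fun u => ∃ v ∈ S, G.dir u v) \ S

/-- `a` is an ancestor of `y` within the induced subgraph of `G` on `S`
(every node is an ancestor of itself). -/
def AncestorIn (G : PDG V) (S : Finset V) (a y : V) : Prop :=
  a ∈ S ∧ y ∈ S ∧ Relation.ReflTransGen (fun u v => G.dir u v ∧ u ∈ S ∧ v ∈ S) a y

/-- `An(Y, G_S)` : the ancestors of `Y` in the induced subgraph of `G` on `S`. -/
def AnIn (G : PDG V) (Y S : Finset V) : Finset V :=
  Finset.univ.filter fun a => ∃ y ∈ Y, G.AncestorIn S a y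

/-- `forb(X, Y, G)` for single nodes `X`, `Y` : all possible descendants of nodes
`W ≠ X` lying on a proper possibly causal path from `X` to `Y` in `G`. -/
def Forb (G : PDG V) (X Y : V) : Finset V :=
  Finset.univ.filter fun w' => ∃ w, w ≠ X ∧
    (∃ p, G.PossiblyCausal p ∧ p.head? = some X ∧ p.getLast? = some Y ∧ w ∈ p) ∧
    G.PossibleDesc w w'

end Fin

end PDG

section Density

open PDG

variable {V : Type} [Fintype V] [DecidableEq V] {Ω : Type} [Fintype Ω] [DecidableEq Ω]

/-- the marginal of `f` over the node set `S`, at the values given by `g`. -/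
def margin (f : (V → Ω) → ℝ) (S : Finset V) (g : V → Ω) : ℝ :=
  ∑ h : V → Ω, if ∀ v ∈ S, h v = g v then f h else 0

/-- the conditional density `f(a | b)` of `A` given `B`, at the values given by `g`. -/
def condOn (f : (V → Ω) → ℝ) (A B : Finset V) (g : V → Ω) : ℝ :=
  margin f (A ∪ B) g / margin f B g

/-- `f` is a strictly positive discrete density over `V`. -/
def IsPosDensity (f : (V → Ω) → ℝ) : Prop :=
  (∀ g, 0 < f g) ∧ ∑ g : V → Ω, f g = 1

/-- `f` is consistent with the DAG `D` : it factorizes according to `D`. -/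
def ConsistentWith (f : (V → Ω) → ℝ) (D : PDG V) : Prop :=
  ∀ g, f g = ∏ v : V, condOn f {v} (D.paFin v) g

/-- the interventional density obtained from `f` by truncated factorization with
respect to the DAG `D` under `do(X = x)`, evaluated at `g` (parent values in `X`
are taken in agreement with `x`). -/
def doDens (f : (V → Ω) → ℝ) (D : PDG V) (X : Finset V) (x : V → Ω) (g : V → Ω) : ℝ :=
  ∏ v ∈ Finset.univ \ X, condOn f {v} (D.paFin v) fun u => if u ∈ X then x u else g u

/-- `f(y | do(x))` : the marginal over `Y` of the interventional density obtained
from `f` by truncated factorization with respect to `D`. -/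
def doMargin (f : (V → Ω) → ℝ) (D : PDG V) (X : Finset V) (x : V → Ω)
    (Y : Finset V) (y : V → Ω) : ℝ :=
  ∑ g : V → Ω,
    if (∀ v ∈ X, g v = x v) ∧ (∀ v ∈ Y, g v = y v) then doDens f D X x g else 0

end Density

open PDG

section Factorization

variable {V : Type} [Fintype V] [DecidableEq V] {Ω : Type} [Fintype Ω] [DecidableEq Ω]

omit [DecidableEq V] in
theorem PDG.mem_paFin {G : PDG V} {u v : V} : u ∈ G.paFin v ↔ G.dir u v := by
  simp [PDG.paFin]

theorem PDG.mem_PaFin {G : PDG V} {S : Finset V} {u : V} :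
    u ∈ G.PaFin S ↔ (∃ v ∈ S, G.dir u v) ∧ u ∉ S := by
  simp [PDG.PaFin]

theorem margin_congr (f : (V → Ω) → ℝ) {S : Finset V} {g g' : V → Ω}
    (h : ∀ v ∈ S, g v = g' v) : margin f S g = margin f S g' := by
  unfold margin
  refine Finset.sum_congr rfl fun k _ => ?_
  have : (∀ v ∈ S, k v = g v) ↔ ∀ v ∈ S, k v = g' v :=
    forall₂_congr fun v hv => by rw [h v hv]
  simp only [this]

theorem margin_univ (f : (V → Ω) → ℝ) (g : V → Ω) : margin f Finset.univ g = f g := by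
  have h : ∀ k : V → Ω, (∀ v ∈ Finset.univ, k v = g v) ↔ k = g := fun k => by
    simp [funext_iff]
  unfold margin
  simp only [h]
  rw [Finset.sum_eq_single g] <;> simp +contextual

theorem margin_pos {f : (V → Ω) → ℝ} (hf : ∀ g, 0 < f g) (S : Finset V) (g : V → Ω) :
    0 < margin f S g := by
  unfold margin
  refine Finset.sum_pos' (fun k _ => ?_) ⟨g, Finset.mem_univ _, ?_⟩
  · split_ifs
    · exact (hf k).le
    · exact le_rfl
  · simpa using hf g

/-- Summing out one coordinate of a marginal. -/
theorem sum_margin_insert (f : (V → Ω) → ℝ) {S : Finset V} {w : V} (hw : w ∉ S)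
    (g : V → Ω) :
    ∑ x, margin f (insert w S) (Function.update g w x) = margin f S g := by
  unfold margin
  rw [Finset.sum_comm]
  refine Finset.sum_congr rfl fun k _ => ?_
  have h : ∀ x, (∀ v ∈ insert w S, k v = Function.update g w x v) ↔
      (k w = x ∧ ∀ v ∈ S, k v = g v) := fun x => by
    rw [Finset.forall_mem_insert, Function.update_self]
    refine and_congr_right fun _ => forall₂_congr fun v hv => ?_
    rw [Function.update_of_ne (ne_of_mem_of_not_mem hv hw)]
  simp only [h]
  by_cases hk : ∀ v ∈ S, k v = g v
  · rw [if_pos hk, Finset.sum_eq_single (k w) (fun x _ hx => if_neg fun e => hx e.1.symm)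
      (fun h' => (h' (Finset.mem_univ _)).elim)]
    exact if_pos ⟨rfl, hk⟩
  · rw [if_neg hk]
    exact Finset.sum_eq_zero fun x _ => if_neg fun hx => hk hx.2

theorem condOn_congr (f : (V → Ω) → ℝ) {A B : Finset V} {g g' : V → Ω}
    (h : ∀ v ∈ A ∪ B, g v = g' v) : condOn f A B g = condOn f A B g' := by
  unfold condOn
  rw [margin_congr f h, margin_congr f fun v hv => h v (Finset.mem_union_right _ hv)]

theorem sum_condOn_singleton {f : (V → Ω) → ℝ} (hf : ∀ g, 0 < f g) {B : Finset V} {w : V}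
    (hw : w ∉ B) (g : V → Ω) :
    ∑ x, condOn f {w} B (Function.update g w x) = 1 := by
  have h : ∀ x, condOn f {w} B (Function.update g w x) =
      margin f (insert w B) (Function.update g w x) / margin f B g := fun x => by
    unfold condOn
    rw [Finset.insert_eq, margin_congr f (S := B) (g := Function.update g w x) (g' := g)]
    intro v hv
    rw [Function.update_of_ne (ne_of_mem_of_not_mem hv hw)]
  simp only [h]
  rw [← Finset.sum_div, sum_margin_insert f hw, div_self (margin_pos hf B g).ne']

/-- `U` is closed under taking parents in `D`. -/
def PDG.IsAncestral (D : PDG V) (U : Finset V) : Prop := ∀ v ∈ U, ∀ u, D.dir u v → u ∈ U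

theorem PDG.Acyclic.exists_minimal_notMem {D : PDG V} (hD : D.Acyclic) {U : Finset V}
    (hU : U ≠ Finset.univ) : ∃ w, w ∉ U ∧ ∀ u, D.dir u w → u ∈ U := by
  have : Std.Irrefl (Relation.TransGen D.dir) := ⟨hD⟩
  have hwf : WellFounded (Relation.TransGen D.dir) :=
    Finite.wellFounded_of_trans_of_irrefl _
  obtain ⟨a, ha⟩ : ∃ a, a ∉ U := by
    by_contra! h
    exact hU (Finset.eq_univ_iff_forall.2 h)
  obtain ⟨w, hw, hmin⟩ := hwf.has_min {a | a ∉ U} ⟨a, ha⟩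
  exact ⟨w, hw, fun u hu => by_contra fun h => hmin u h (Relation.TransGen.single hu)⟩

/-- A density that factorizes according to a DAG has factorizing marginals over
ancestral sets. -/
theorem margin_eq_prod_of_isAncestral {f : (V → Ω) → ℝ} (hf : ∀ g, 0 < f g) {D : PDG V}
    (hD : D.Acyclic) (hcons : ConsistentWith f D) {U : Finset V} (hU : D.IsAncestral U)
    (g : V → Ω) : margin f U g = ∏ v ∈ U, condOn f {v} (D.paFin v) g := by
  induction hn : Uᶜ.card using Nat.strong_induction_on generalizing U g with
  | _ n ih =>
  by_cases hUu : U = Finset.univ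
  · rw [hUu, margin_univ, hcons g]
  obtain ⟨w, hw, hpa⟩ := hD.exists_minimal_notMem hUu
  have hU' : D.IsAncestral (insert w U) := by
    intro v hv u hu
    rcases Finset.mem_insert.1 hv with rfl | hv
    · exact Finset.mem_insert_of_mem (hpa u hu)
    · exact Finset.mem_insert_of_mem (hU v hv u hu)
  have hcard : (insert w U)ᶜ.card < n := by
    rw [← hn]
    refine Finset.card_lt_card (Finset.compl_ssubset_compl.2 (Finset.ssubset_insert hw))
  have hstep : ∀ x, margin f (insert w U) (Function.update g w x) =
      condOn f {w} (D.paFin w) (Function.update g w x) *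
        ∏ v ∈ U, condOn f {v} (D.paFin v) g := fun x => by
    rw [ih _ hcard hU' _ rfl, Finset.prod_insert hw]
    congr 1
    refine Finset.prod_congr rfl fun v hv => condOn_congr f fun u hu => ?_
    refine Function.update_of_ne (fun e => hw ?_) _ _
    subst e
    rcases Finset.mem_union.1 hu with hu | hu
    · rwa [Finset.mem_singleton.1 hu]
    · exact hU v hv u (PDG.mem_paFin.1 hu)
  rw [← sum_margin_insert f hw g, Finset.sum_congr rfl fun x _ => hstep x, ← Finset.sum_mul,
    sum_condOn_singleton hf fun h => D.dir_irrefl w (PDG.mem_paFin.1 h), one_mul]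

/-- If a marginal over `S ∪ T` splits off a factor `F` that only depends on `S ∪ P`,
then so does the marginal over `S ∪ P`. -/
theorem margin_union_eq_mul_of_subset {f : (V → Ω) → ℝ} {S P T : Finset V} {F : (V → Ω) → ℝ}
    (hF : ∀ g g' : V → Ω, (∀ v ∈ S ∪ P, g v = g' v) → F g = F g')
    (hPT : P ⊆ T) (hST : Disjoint S T)
    (hT : ∀ g, margin f (S ∪ T) g = margin f T g * F g) (g : V → Ω) :
    margin f (S ∪ P) g = margin f P g * F g := by
  induction hn : T.card using Nat.strong_induction_on generalizing T with
  | _ n ih =>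
  by_cases hTP : T ⊆ P
  · rw [hPT.antisymm hTP, hT]
  obtain ⟨w, hwT, hwP⟩ := Finset.not_subset.1 hTP
  have hwS : w ∉ S := Finset.disjoint_right.1 hST hwT
  refine ih _ (hn ▸ Finset.card_erase_lt_of_mem hwT)
    (fun v hv => Finset.mem_erase.2 ⟨ne_of_mem_of_not_mem hv hwP, hPT hv⟩)
    (hST.mono_right (Finset.erase_subset _ _)) (fun g => ?_) rfl
  have hins : insert w (S ∪ T.erase w) = S ∪ T := by
    rw [← Finset.union_insert, Finset.insert_erase hwT]
  have hw : w ∉ S ∪ T.erase w := by simp [hwS]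
  have hstep : ∀ x, F (Function.update g w x) = F g := fun x => by
    refine hF _ _ fun v hv => Function.update_of_ne (fun e => ?_) _ _
    subst e
    exact (Finset.mem_union.1 hv).elim hwS hwP
  rw [← sum_margin_insert f hw g, ← sum_margin_insert f (Finset.notMem_erase w T) g, hins,
    Finset.insert_erase hwT, Finset.sum_mul]
  exact Finset.sum_congr rfl fun x _ => by rw [hT, hstep]

theorem condOn_eq_prod_of_isAncestral {f : (V → Ω) → ℝ} (hf : ∀ g, 0 < f g) {D : PDG V}
    (hD : D.Acyclic) (hcons : ConsistentWith f D) {S P T : Finset V}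
    (hT : D.IsAncestral T) (hST : D.IsAncestral (S ∪ T)) (hdisj : Disjoint S T) (hPT : P ⊆ T)
    (hpa : ∀ v ∈ S, D.paFin v ⊆ S ∪ P) (g : V → Ω) :
    condOn f S P g = ∏ v ∈ S, condOn f {v} (D.paFin v) g := by
  rw [condOn, div_eq_iff (margin_pos hf P g).ne', mul_comm]
  refine margin_union_eq_mul_of_subset (F := fun g => ∏ v ∈ S, condOn f {v} (D.paFin v) g)
    (fun g g' h => ?_) hPT hdisj (fun g => ?_) g
  · refine Finset.prod_congr rfl fun v hv => condOn_congr f fun u hu => h u ?_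
    rcases Finset.mem_union.1 hu with hu | hu
    · exact Finset.mem_union_left _ (Finset.mem_singleton.1 hu ▸ hv)
    · exact hpa v hv hu
  · rw [margin_eq_prod_of_isAncestral hf hD hcons hST,
      margin_eq_prod_of_isAncestral hf hD hcons hT, Finset.prod_union hdisj, mul_comm]

omit [Fintype V] in
theorem Finset.mem_foldr_union {L : List (Finset V)} {v : V} :
    v ∈ L.foldr (· ∪ ·) ∅ ↔ ∃ B ∈ L, v ∈ B := by
  induction L with
  | nil => simp
  | cons B L ih => simp [ih]

omit [Fintype V] in
theorem Finset.prod_foldr_union {L : List (Finset V)} (h : L.Pairwise fun B B' : Finset V => Disjoint B B')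
    (F : V → ℝ) :
    ∏ v ∈ L.foldr (· ∪ ·) ∅, F v = (L.map fun B => ∏ v ∈ B, F v).prod := by
  induction L with
  | nil => simp
  | cons B L ih =>
    rw [List.pairwise_cons] at h
    have hd : Disjoint B (L.foldr (· ∪ ·) ∅) := by
      rw [Finset.disjoint_left]
      intro v hv hv'
      obtain ⟨B', hB', hvB'⟩ := Finset.mem_foldr_union.1 hv'
      exact Finset.disjoint_left.1 (h.1 B' hB') hv hvB'
    rw [List.foldr_cons, Finset.prod_union hd, ih h.2, List.map_cons, List.prod_cons]

omit [Fintype V] [DecidableEq V] in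
/-- Edges of a represented DAG never point from a later set of a partial causal ordering
to an earlier one. -/
theorem PDG.InClassOf.le_of_dir {D G : PDG V} (hDG : D.InClassOf G) {Vs : List (Finset V)}
    (hord : G.OrderedDecomp Vs) {i j : Fin Vs.length} {u v : V} (hu : u ∈ Vs.get i)
    (hv : v ∈ Vs.get j) (huv : D.dir u v) : i ≤ j := by
  by_contra! h
  have hadj : G.Adj v u := (hDG.2.1 v u).2 (Or.inr (Or.inl huv))
  exact D.dir_asymm u v huv (hDG.2.2.2 v u (hord j i h v hv u hu hadj))

theorem PDG.InClassOf.condOn_get_eq_prod {D G : PDG V} (hDG : D.InClassOf G)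
    {Vs : List (Finset V)} (hdec : G.IsBucketDecompList Finset.univ Vs)
    (hord : G.OrderedDecomp Vs) {f : (V → Ω) → ℝ} (hf : ∀ g, 0 < f g)
    (hcons : ConsistentWith f D) (i : Fin Vs.length) (g : V → Ω) :
    condOn f (Vs.get i) (G.PaFin (Vs.get i)) g =
      ∏ v ∈ Vs.get i, condOn f {v} (D.paFin v) g := by
  have hex : ∀ v, ∃ j, v ∈ Vs.get j := fun v => by
    obtain ⟨B, hB, hv⟩ := Finset.mem_foldr_union.1 (hdec.2.2 ▸ Finset.mem_univ v)
    obtain ⟨j, rfl⟩ := List.get_of_mem hB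
    exact ⟨j, hv⟩
  have hdisj : ∀ {j}, j < i → Disjoint (Vs.get j) (Vs.get i) := fun {j} h =>
    List.pairwise_iff_get.1 hdec.2.1 j i h
  let T : Finset V := Finset.univ.filter fun v => ∃ j < i, v ∈ Vs.get j
  have hmemT : ∀ {v}, v ∈ T ↔ ∃ j < i, v ∈ Vs.get j := by simp [T]
  refine condOn_eq_prod_of_isAncestral hf hDG.1.2 hcons (T := T) ?_ ?_ ?_ ?_ ?_ g
  · intro v hv u hu
    obtain ⟨j, hj, hvj⟩ := hmemT.1 hv
    obtain ⟨k, huk⟩ := hex u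
    exact hmemT.2 ⟨k, (hDG.le_of_dir hord huk hvj hu).trans_lt hj, huk⟩
  · have key : ∀ j ≤ i, ∀ v ∈ Vs.get j, ∀ u, D.dir u v → u ∈ Vs.get i ∪ T := by
      intro j hj v hv u hu
      obtain ⟨k, huk⟩ := hex u
      rcases ((hDG.le_of_dir hord huk hv hu).trans hj).eq_or_lt with rfl | hk
      · exact Finset.mem_union_left _ huk
      · exact Finset.mem_union_right _ (hmemT.2 ⟨k, hk, huk⟩)
    intro v hv u hu
    rcases Finset.mem_union.1 hv with hv | hv
    · exact key i le_rfl v hv u hu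
    · obtain ⟨j, hj, hvj⟩ := hmemT.1 hv
      exact key j hj.le v hvj u hu
  · rw [Finset.disjoint_right]
    intro v hv hvi
    obtain ⟨j, hj, hvj⟩ := hmemT.1 hv
    exact Finset.disjoint_left.1 (hdisj hj) hvj hvi
  · intro u hu
    obtain ⟨⟨v, hv, huv⟩, hui⟩ := PDG.mem_PaFin.1 hu
    obtain ⟨k, huk⟩ := hex u
    refine hmemT.2 ⟨k, lt_of_le_of_ne (hDG.le_of_dir hord huk hv (hDG.2.2.2 u v huv)) ?_, huk⟩
    rintro rfl
    exact hui huk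
  · intro v hv u hu
    have huv := PDG.mem_paFin.1 hu
    by_cases hui : u ∈ Vs.get i
    · exact Finset.mem_union_left _ hui
    obtain ⟨k, huk⟩ := hex u
    have hki : k < i := lt_of_le_of_ne (hDG.le_of_dir hord huk hv huv) fun e => hui (e ▸ huk)
    exact Finset.mem_union_right _ (PDG.mem_PaFin.2
      ⟨⟨v, hv, hord k i hki u huk v hv ((hDG.2.1 u v).2 (Or.inl huv))⟩, hui⟩)

end Factorization

/-- factorization of an observational density consistent with an MPDAG
according to the ordered bucket decomposition. -/
theorem stmt3 {V : Type} [Fintype V] [DecidableEq V]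
    {Ω : Type} [Fintype Ω] [DecidableEq Ω]
    (G : PDG V) (hG : G.IsMPDAG)
    (Vs : List (Finset V)) (hk : Vs ≠ [])
    (hdec : G.IsBucketDecompList Finset.univ Vs) (hord : G.OrderedDecomp Vs)
    (f : (V → Ω) → ℝ) (hf : IsPosDensity f)
    (hcons : ∃ D : PDG V, D.InClassOf G ∧ ConsistentWith f D)
    (g : V → Ω) :
    f g = (Vs.map fun Vi => condOn f Vi (G.PaFin Vi) g).prod := by
  obtain ⟨D, hDG, hD⟩ := hcons
  rw [hD g, ← hdec.2.2, Finset.prod_foldr_union hdec.2.1]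
  refine congrArg List.prod (List.map_congr_left fun B hB => ?_)
  obtain ⟨i, rfl⟩ := List.get_of_mem hB
  exact (hDG.condOn_get_eq_prod hdec hord hf.1 hD i g).symm
end
end

section
/- Let G = (V,E) be an MPDAG with V nonempty, and let C_1,…,C_k be the buckets of the bucket decomposition of V. Then there exists an index i ∈ {1,…,k} such that every edge of G between C_i and V ∖ C_i is directed into C_i (i.e., for every edge between A ∈ V ∖ C_i and B ∈ C_i, the edge is A → B). -/
open scoped Classical

noncomputable section

open PDG

namespace PDG

variable {V : Type} {G : PDG V}

/-- The simple graph formed by the undirected edges of `G`. -/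
def undirGraph (G : PDG V) : SimpleGraph V where
  Adj := G.undir
  symm := ⟨G.undir_symm⟩
  loopless := ⟨G.undir_irrefl⟩

theorem exists_isUndirPath_iff_reachable {a b : V} :
    (∃ p, G.IsUndirPath p ∧ p.head? = some a ∧ p.getLast? = some b) ↔
      G.undirGraph.Reachable a b := by
  constructor
  · rintro ⟨p, ⟨hne, -, hc⟩, ha, hb⟩
    have hr := List.relationReflTransGen_of_exists_isChain p hc hne
    rw [List.head?_eq_some_head hne, Option.some_inj] at ha
    rw [List.getLast?_eq_some_getLast hne, Option.some_inj] at hb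
    rw [ha, hb] at hr
    exact (SimpleGraph.reachable_iff_reflTransGen a b).2 hr
  · rintro ⟨w⟩
    refine ⟨w.toPath.1.support, ⟨SimpleGraph.Walk.support_ne_nil _, w.toPath.2.support_nodup,
      w.toPath.1.isChain_adj_support⟩, ?_, ?_⟩
    · rw [List.head?_eq_some_head (SimpleGraph.Walk.support_ne_nil _),
        SimpleGraph.Walk.head_support]
    · rw [List.getLast?_eq_some_getLast (SimpleGraph.Walk.support_ne_nil _),
        SimpleGraph.Walk.getLast_support]

theorem undirConnected_iff {A : Finset V} :
    G.UndirConnected A ↔ ∀ a ∈ A, ∀ b ∈ A, G.undirGraph.Reachable a b := by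
  simp only [UndirConnected, exists_isUndirPath_iff_reachable]
  refine ⟨fun h a ha b hb => ?_, fun h a ha b hb _ => h a ha b hb⟩
  by_cases hab : a = b
  · rw [hab]
  · exact h a ha b hb hab

/-- The undirected component of a node is a bucket in the set of all nodes. -/
theorem bucket_filter_reachable [Fintype V] [DecidableEq V] (G : PDG V) (x : V) :
    G.Bucket (Finset.univ.filter (G.undirGraph.Reachable x)) Finset.univ := by
  refine ⟨⟨x, by simp⟩, Finset.subset_univ _, ?_, fun B hB _ hconn => ?_⟩
  · rw [undirConnected_iff]
    intro a ha b hb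
    exact (Finset.mem_filter.1 ha).2.symm.trans (Finset.mem_filter.1 hb).2
  · refine Finset.Subset.antisymm (fun v hv => ?_) hB
    have hx : x ∈ B := hB (by simp)
    simpa using undirConnected_iff.1 hconn x hx v hv

/-- A directed edge into another undirected component forces directed edges into
all of that component. -/
theorem IsMPDAG.dir_of_reachable (hG : G.IsMPDAG) {a b c : V} (hab : G.dir a b)
    (hnot : ¬ G.undirGraph.Reachable a b) (hbc : G.undirGraph.Reachable b c) : G.dir a c := by
  have hbc' := hbc
  rw [SimpleGraph.reachable_iff_reflTransGen] at hbc'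
  induction hbc' with
  | refl => exact hab
  | @tail d e hbd hde ih =>
    have hbd : G.undirGraph.Reachable b d := (SimpleGraph.reachable_iff_reflTransGen b d).2 hbd
    have had := ih hbd
    rcases hG.meek1 a d e had hde with h | h | h
    · exact h
    · exact absurd (G.undir_symm d e hde) (hG.meek2 e a d h had)
    · exact absurd ((show G.undirGraph.Adj a e from h).reachable.trans hbc.symm) hnot

/-- In a finite acyclic graph, every nonempty set has a node without directed edges into the set. -/
theorem Acyclic.exists_maximal [Finite V] (hG : G.Acyclic) {S : Set V} (hS : S.Nonempty) :
    ∃ m ∈ S, ∀ y ∈ S, ¬ G.dir m y := by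
  have : Std.Irrefl (fun a b => Relation.TransGen G.dir b a) := ⟨hG⟩
  have : IsTrans V (fun a b => Relation.TransGen G.dir b a) := ⟨fun _ _ _ h h' => h'.trans h⟩
  have hwf := Finite.wellFounded_of_trans_of_irrefl (fun a b => Relation.TransGen G.dir b a)
  obtain ⟨m, hm, hmax⟩ := hwf.has_min S hS
  exact ⟨m, hm, fun y hy h => hmax y hy (.single h)⟩

/-- Some undirected component has no directed edge leaving it. -/
theorem IsMPDAG.exists_forall_dir_reachable [Finite V] [Nonempty V] (hG : G.IsMPDAG) :
    ∃ x, ∀ y z, G.undirGraph.Reachable x y → G.dir y z → G.undirGraph.Reachable y z := by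
  by_contra! h
  obtain ⟨y₀, z₀, -, hdir₀, hnot₀⟩ := h (Classical.arbitrary V)
  obtain ⟨m, ⟨z, hmz, hnot⟩, hmax⟩ := hG.acyclic.exists_maximal
    (S := {y | ∃ z, G.dir y z ∧ ¬ G.undirGraph.Reachable y z}) ⟨y₀, z₀, hdir₀, hnot₀⟩
  obtain ⟨y, w, hzy, hyw, hnot'⟩ := h z
  exact hmax y ⟨w, hyw, hnot'⟩ (hG.dir_of_reachable hmz hnot hzy)

end PDG

/-- among the buckets of `V` there is one into which all edges from the
rest of the graph point. -/
theorem stmt7 {V : Type} [Fintype V] [DecidableEq V] [Nonempty V]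
    (G : PDG V) (hG : G.IsMPDAG) :
    ∃ C : Finset V, G.Bucket C Finset.univ ∧
      ∀ a b : V, a ∉ C → b ∈ C → G.Adj a b → G.dir a b := by
  obtain ⟨x, hx⟩ := hG.exists_forall_dir_reachable
  refine ⟨Finset.univ.filter (G.undirGraph.Reachable x), G.bucket_filter_reachable x,
    fun a b ha hb hab => ?_⟩
  simp only [Finset.mem_filter, Finset.mem_univ, true_and] at ha hb
  rcases hab with h | h | h
  · exact h
  · exact absurd (hb.trans (hx b a hb h)) ha
  · exact absurd (hb.trans (show G.undirGraph.Adj a b from h).reachable.symm) ha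
end
end
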